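/- If a sequence (x_n) on T exhibits Poissonian correlation of 2k-fold differences at rate α for some 0 ≤ α ≤ k, meaning for all s > 0, lim_{N→∞} (1/N^{2k-α}) #{1 ≤ a_j, b_j ≤ N, multisets {a_j} ≠ {b_j} : ‖Σ_j x_{a_j} - Σ_j x_{b_j}‖ ≤ s/N^α} = 2s, then (x_n) is equidistributed. -/

import Mathlib

open Filter
open scoped Classical BigOperators

noncomputable section

/-- distance from a real number to the nearest integer (the torus norm). -/
def tdist (y : ℝ) : ℝ := |y - round y|

/-- number of pairs of tuples `a, b ∈ {1,…,N}^k` with distinct multisets of entries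
such that `‖Σ_j x_{a_j} - Σ_j x_{b_j}‖ ≤ ε`. -/
def kfoldCount (x : ℕ → ℝ) (k N : ℕ) (ε : ℝ) : ℕ :=
  (((Fintype.piFinset fun _ : Fin k => Finset.Icc 1 N) ×ˢ
      (Fintype.piFinset fun _ : Fin k => Finset.Icc 1 N)).filter
    (fun p => (↑(List.ofFn p.1) : Multiset ℕ) ≠ ↑(List.ofFn p.2) ∧
      tdist (∑ j, x (p.1 j) - ∑ j, x (p.2 j)) ≤ ε)).card

/-- equidistribution on the torus. -/
def Equidistributed (x : ℕ → ℝ) : Prop :=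
  ∀ a b : ℝ, 0 ≤ a → a ≤ b → b ≤ 1 →
    Tendsto (fun N : ℕ =>
      (((Finset.Icc 1 N).filter
        (fun n => a ≤ Int.fract (x n) ∧ Int.fract (x n) < b)).card : ℝ) / N)
      atTop (nhds (b - a))

open MeasureTheory Topology

/-- The character `y ↦ e(m y)` of the torus, as a function on the real line. -/
def torusChar (m : ℤ) (y : ℝ) : ℂ := Complex.exp ((2 * Real.pi * m * y : ℝ) * Complex.I)

lemma norm_torusChar (m : ℤ) (y : ℝ) : ‖torusChar m y‖ = 1 :=
  Complex.norm_exp_ofReal_mul_I _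

lemma torusChar_sum {ι : Type*} (m : ℤ) (s : Finset ι) (f : ι → ℝ) :
    torusChar m (∑ i ∈ s, f i) = ∏ i ∈ s, torusChar m (f i) := by
  simp only [torusChar]
  rw [← Complex.exp_sum, ← Finset.sum_mul, Finset.mul_sum]
  push_cast
  rfl

lemma norm_torusChar_sub_le (m : ℤ) (y z : ℝ) :
    ‖torusChar m y - torusChar m z‖ ≤ 2 * Real.pi * |(m : ℝ)| * |y - z| := by
  have h : torusChar m y - torusChar m z
      = torusChar m z * (Complex.exp (Complex.I * (2 * Real.pi * m * (y - z) : ℝ)) - 1) := by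
    simp only [torusChar]
    rw [mul_sub, ← Complex.exp_add, mul_one]
    congr 2
    push_cast
    ring
  rw [h, norm_mul, norm_torusChar, one_mul]
  refine Real.norm_exp_I_mul_ofReal_sub_one_le.trans (le_of_eq ?_)
  rw [Real.norm_eq_abs, abs_mul, abs_mul, abs_mul, abs_two, abs_of_pos Real.pi_pos]

lemma norm_sum_mul_sq_le {J : Type*} [Fintype J] (G : J → ℝ) (χ : J → ℂ)
    (hχ : ∀ j, ‖χ j‖ = 1) (h0 : ∑ j, χ j = 0) :
    ‖∑ j, (G j : ℂ) * χ j‖ ^ 2 ≤ Fintype.card J * ∑ j, G j ^ 2 - (∑ j, G j) ^ 2 := by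
  rcases isEmpty_or_nonempty J with hJ | hJ
  · simp
  have hc : (0 : ℝ) < Fintype.card J := by exact_mod_cast Fintype.card_pos
  set c : ℝ := (∑ j, G j) / Fintype.card J with hcdef
  have hsum : ∑ j, G j = c * Fintype.card J := by rw [hcdef]; field_simp
  have h1 : ∑ j, (G j : ℂ) * χ j = ∑ j, ((G j - c : ℝ) : ℂ) * χ j := by
    simp only [Complex.ofReal_sub, sub_mul, Finset.sum_sub_distrib, ← Finset.mul_sum, h0,
      mul_zero, sub_zero]
  have h2 : ‖∑ j, (G j : ℂ) * χ j‖ ≤ ∑ j, |G j - c| := by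
    rw [h1]
    refine (norm_sum_le _ _).trans (le_of_eq (Finset.sum_congr rfl fun j _ => ?_))
    rw [norm_mul, hχ, mul_one, Complex.norm_real, Real.norm_eq_abs]
  have h3 : (∑ j, |G j - c|) ^ 2 ≤ Fintype.card J * ∑ j, (G j - c) ^ 2 := by
    simpa only [sq_abs, Finset.card_univ] using
      sq_sum_le_card_mul_sum_sq (s := Finset.univ) (f := fun j => |G j - c|)
  have h4 : ∑ j, (G j - c) ^ 2 = ∑ j, G j ^ 2 - c ^ 2 * Fintype.card J := by
    have : ∀ j, (G j - c) ^ 2 = G j ^ 2 - 2 * c * G j + c ^ 2 := fun j => by ring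
    simp only [this, Finset.sum_add_distrib, Finset.sum_sub_distrib, ← Finset.mul_sum, hsum,
      Finset.sum_const, Finset.card_univ, nsmul_eq_mul]
    ring
  calc _ ≤ (∑ j, |G j - c|) ^ 2 := by gcongr
    _ ≤ _ := h3
    _ = _ := by rw [h4, hsum]; ring

lemma sum_sq_card_fiber {P J : Type*} [Fintype J] [DecidableEq J] (s : Finset P) (f : P → J) :
    ∑ j, (s.filter fun p => f p = j).card ^ 2
      = ∑ p ∈ s, ∑ q ∈ s, if f p = f q then 1 else 0 := by
  have : ∀ p ∈ s, (∑ q ∈ s, if f p = f q then 1 else 0)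
      = (s.filter fun q => f q = f p).card := fun p _ => by
    simp only [Finset.card_filter, eq_comm]
  rw [Finset.sum_congr rfl this, ← Finset.sum_fiberwise s f]
  refine Finset.sum_congr rfl fun j _ => ?_
  rw [Finset.sum_congr rfl (g := fun _ => (s.filter fun p => f p = j).card), Finset.sum_const,
    smul_eq_mul, sq]
  intro p hp
  rw [(Finset.mem_filter.1 hp).2]

lemma tdist_le_abs_sub_int (y : ℝ) (z : ℤ) : tdist y ≤ |y - z| := round_le y z

/-- A discrete form of the fact that a triangle function is the autocorrelation of an interval. -/
lemma card_bin_shifts_le (M L : ℕ) [NeZero M] (hLM : 2 * L ≤ M) (y z : ℝ) :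
    (∑ i ∈ Finset.range L, ∑ j ∈ Finset.range L,
      if ((⌊M * y⌋ : ℤ) : ZMod M) - (i : ZMod M) = ((⌊M * z⌋ : ℤ) : ZMod M) - (j : ZMod M)
        then 1 else 0)
      ≤ ∑ r ∈ Finset.Icc 1 L, if tdist (y - z) ≤ (r : ℝ) / M then 1 else 0 := by
  have hM : (0 : ℝ) < M := by exact_mod_cast Nat.pos_of_ne_zero (NeZero.ne M)
  have hdvd : ∀ i j : ℕ,
      ((⌊M * y⌋ : ℤ) : ZMod M) - (i : ZMod M) = ((⌊M * z⌋ : ℤ) : ZMod M) - (j : ZMod M) →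
      ∃ c : ℤ, ⌊M * y⌋ - ⌊M * z⌋ = (i : ℤ) - j + M * c := by
    intro i j hij
    have : (((⌊M * y⌋ - i) - (⌊M * z⌋ - j) : ℤ) : ZMod M) = 0 := by
      push_cast
      rw [hij, sub_self]
    obtain ⟨c, hc⟩ := (ZMod.intCast_zmod_eq_zero_iff_dvd _ M).1 this
    exact ⟨c, by linarith⟩
  rw [← Finset.sum_product', ← Finset.card_filter, ← Finset.card_filter]
  refine Finset.card_le_card_of_injOn (fun p => max p.1 p.2 + 1) ?_ ?_
  · rintro ⟨i, j⟩ hp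
    simp only [Finset.coe_filter, Finset.mem_product, Finset.mem_range, Set.mem_ofPred_eq,
      Finset.mem_Icc] at hp ⊢
    obtain ⟨c, hc⟩ := hdvd i j hp.2
    refine ⟨by omega, (tdist_le_abs_sub_int _ c).trans ?_⟩
    have habs : |y - z - c| * M = |(y - z - c) * M| := by rw [abs_mul, abs_of_pos hM]
    rw [le_div_iff₀ hM, habs]
    have hc' : ((⌊M * y⌋ : ℤ) : ℝ) - (⌊M * z⌋ : ℤ) = (i : ℝ) - j + M * c := by exact_mod_cast hc
    have h1 := Int.floor_le (M * y)
    have h2 := Int.lt_floor_add_one (M * y)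
    have h3 := Int.floor_le (M * z)
    have h4 := Int.lt_floor_add_one (M * z)
    have h5 : (i : ℝ) ≤ max (i : ℝ) j := le_max_left _ _
    have h6 : (j : ℝ) ≤ max (i : ℝ) j := le_max_right _ _
    have h7 : (0 : ℝ) ≤ i := by positivity
    have h8 : (0 : ℝ) ≤ j := by positivity
    push_cast
    rw [abs_le]
    constructor <;> nlinarith
  · rintro ⟨i, j⟩ hp ⟨i', j'⟩ hp' he
    simp only [Finset.coe_filter, Finset.mem_product, Finset.mem_range, Set.mem_ofPred_eq]
      at hp hp' he
    obtain ⟨c, hc⟩ := hdvd i j hp.2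
    obtain ⟨c', hc'⟩ := hdvd i' j' hp'.2
    have hcc : (M : ℤ) * (c' - c) = (i : ℤ) - j - (i' - j') := by linarith
    have hz : c' - c = 0 := by
      have hMz : (0 : ℤ) < M := by exact_mod_cast Nat.pos_of_ne_zero (NeZero.ne M)
      have hlt : |(M : ℤ) * (c' - c)| < M := by
        rw [hcc, abs_lt]
        omega
      rw [abs_mul, abs_of_pos hMz] at hlt
      exact Int.abs_lt_one_iff.1 (by nlinarith)
    rw [hz, mul_zero] at hcc
    simp only [Prod.mk.injEq]
    omega

/-- An exponential sum over the points `S a` is bounded by the excess of close pairs: the number of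
points in a sliding window of `L` out of `M` bins has small variance when there are few close pairs,
and the exponential sum is controlled by that variance. -/
lemma norm_sum_torusChar_le {ι : Type*} (A : Finset ι) (S : ι → ℝ) (M L : ℕ) [NeZero M]
    (hL : 0 < L) (hLM : 2 * L ≤ M) (m : ℤ) (hm : ¬ (M : ℤ) ∣ m) :
    ‖∑ a ∈ A, torusChar m (S a)‖ ≤ A.card * (2 * Real.pi * |(m : ℝ)| * (L / M)) +
      √(M * (∑ r ∈ Finset.Icc 1 L, (((A ×ˢ A).filter fun p =>
        tdist (S p.1 - S p.2) ≤ (r : ℝ) / M).card : ℝ)) / L ^ 2 - (A.card : ℝ) ^ 2) := by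
  have hM : (0 : ℝ) < M := by exact_mod_cast Nat.pos_of_ne_zero (NeZero.ne M)
  have hL' : (0 : ℝ) < L := by exact_mod_cast hL
  set Q : ℝ := ∑ r ∈ Finset.Icc 1 L, (((A ×ˢ A).filter fun p =>
        tdist (S p.1 - S p.2) ≤ (r : ℝ) / M).card : ℝ) with hQ
  set P := A ×ˢ Finset.range L with hP
  let f : ι × ℕ → ZMod M := fun p => ((⌊M * S p.1⌋ : ℤ) : ZMod M) - (p.2 : ZMod M)
  let χ : ZMod M → ℂ := fun j => ZMod.stdAddChar (j * (m : ZMod M))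
  let G : ZMod M → ℝ := fun j => ((P.filter fun p => f p = j).card : ℝ)
  have hχ : ∀ j, ‖χ j‖ = 1 := fun j => by
    simp only [χ, ZMod.stdAddChar_apply, Circle.norm_coe]
  have hχ0 : ∑ j, χ j = 0 := by
    have hm' : (m : ZMod M) ≠ 0 := fun h => hm ((ZMod.intCast_zmod_eq_zero_iff_dvd _ M).1 h)
    simp only [χ]
    rw [AddChar.sum_mulShift _ (ZMod.isPrimitive_stdAddChar M), if_neg hm', Nat.cast_zero]
  have hχf : ∀ p, χ (f p) = torusChar m ((⌊M * S p.1⌋ - p.2) / M) := fun p => by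
    have : f p * (m : ZMod M) = (((⌊M * S p.1⌋ - p.2) * m : ℤ) : ZMod M) := by
      simp only [f]
      push_cast
      rfl
    simp only [χ]
    rw [this, ZMod.stdAddChar_coe, torusChar]
    congr 1
    push_cast
    ring
  have hK : ∑ p ∈ P, χ (f p) = ∑ j, (G j : ℂ) * χ j := by
    rw [← Finset.sum_fiberwise P f]
    refine Finset.sum_congr rfl fun j _ => ?_
    rw [Finset.sum_congr rfl (g := fun _ => χ j), Finset.sum_const, nsmul_eq_mul]
    · simp [G]
    · intro p hp
      rw [(Finset.mem_filter.1 hp).2]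
  have hG : ∑ j, G j = A.card * L := by
    have := Finset.card_eq_sum_card_fiberwise (s := P) (t := Finset.univ) (f := f)
      (fun _ _ => Finset.mem_coe.2 (Finset.mem_univ _))
    rw [hP, Finset.card_product, Finset.card_range] at this
    simp only [G]
    exact_mod_cast this.symm
  have hG2 : ∑ j, G j ^ 2 ≤ Q := by
    have h1 : ∑ j, (P.filter fun p => f p = j).card ^ 2
        ≤ ∑ r ∈ Finset.Icc 1 L, ((A ×ˢ A).filter fun p =>
          tdist (S p.1 - S p.2) ≤ (r : ℝ) / M).card := by
      rw [sum_sq_card_fiber]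
      simp only [Finset.card_filter]
      rw [Finset.sum_comm (s := Finset.Icc 1 L), hP, Finset.sum_product, Finset.sum_product]
      refine Finset.sum_le_sum fun a _ => ?_
      simp only [Finset.sum_product]
      rw [Finset.sum_comm]
      exact Finset.sum_le_sum fun b _ => card_bin_shifts_le M L hLM (S a) (S b)
    rw [hQ]
    simp only [G]
    exact_mod_cast h1
  have hKle : ‖∑ p ∈ P, χ (f p)‖ ≤ L * √(M * Q / L ^ 2 - (A.card : ℝ) ^ 2) := by
    rw [hK]
    have h1 := norm_sum_mul_sq_le G χ hχ hχ0
    rw [hG, ZMod.card] at h1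
    have h2 : ‖∑ j, (G j : ℂ) * χ j‖ ^ 2 ≤ L ^ 2 * (M * Q / L ^ 2 - (A.card : ℝ) ^ 2) := by
      have h3 : (L : ℝ) ^ 2 * (M * Q / L ^ 2 - (A.card : ℝ) ^ 2) = M * Q - (A.card * L) ^ 2 := by
        field_simp
      rw [h3]
      exact h1.trans (by gcongr)
    have h4 := Real.le_sqrt_of_sq_le h2
    rwa [Real.sqrt_mul (by positivity), Real.sqrt_sq hL'.le] at h4
  have hclose : ‖(L : ℂ) * ∑ a ∈ A, torusChar m (S a) - ∑ p ∈ P, χ (f p)‖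
      ≤ A.card * L * (2 * Real.pi * |(m : ℝ)| * (L / M)) := by
    have h1 : (L : ℂ) * ∑ a ∈ A, torusChar m (S a) = ∑ p ∈ P, torusChar m (S p.1) := by
      rw [hP, Finset.sum_product, Finset.mul_sum]
      simp
    rw [h1, ← Finset.sum_sub_distrib]
    refine (norm_sum_le_of_le (f := fun p : ι × ℕ => torusChar m (S p.1) - χ (f p)) P
      (n := fun _ => 2 * Real.pi * |(m : ℝ)| * (L / M)) fun p hp => ?_).trans (le_of_eq ?_)
    · rw [hχf]
      refine (norm_torusChar_sub_le _ _ _).trans ?_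
      gcongr
      have h2 := Int.floor_le (M * S p.1)
      have h3 := Int.lt_floor_add_one (M * S p.1)
      have h4 : (p.2 : ℝ) + 1 ≤ L := by
        exact_mod_cast Finset.mem_range.1 (Finset.mem_product.1 hp).2
      have h5 : (0 : ℝ) ≤ p.2 := by positivity
      have h6 : S p.1 - (⌊M * S p.1⌋ - p.2) / M = (M * S p.1 - ⌊M * S p.1⌋ + p.2) / M := by
        field_simp
        ring
      rw [h6, abs_of_nonneg (div_nonneg (by linarith) hM.le)]
      gcongr
      linarith
    · rw [Finset.sum_const, hP, Finset.card_product, Finset.card_range, nsmul_eq_mul]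
      push_cast
      ring
  have hfin : (L : ℝ) * ‖∑ a ∈ A, torusChar m (S a)‖
      ≤ L * (A.card * (2 * Real.pi * |(m : ℝ)| * (L / M)) +
        √(M * Q / L ^ 2 - (A.card : ℝ) ^ 2)) := by
    have h1 : (L : ℝ) * ‖∑ a ∈ A, torusChar m (S a)‖ = ‖(L : ℂ) * ∑ a ∈ A, torusChar m (S a)‖ := by
      rw [norm_mul, Complex.norm_natCast]
    rw [h1]
    have h2 := norm_le_norm_sub_add ((L : ℂ) * ∑ a ∈ A, torusChar m (S a)) (∑ p ∈ P, χ (f p))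
    linarith
  exact le_of_mul_le_mul_left hfin hL'

/-- Convergence of all Fourier coefficients implies weak convergence of probability measures on the
circle. -/
lemma MeasureTheory.ProbabilityMeasure.tendsto_of_tendsto_integral_fourier {T : ℝ} [Fact (0 < T)] {ι : Type*}
    {l : Filter ι} {μs : ι → ProbabilityMeasure (AddCircle T)} {μ : ProbabilityMeasure (AddCircle T)}
    (h : ∀ m : ℤ, Tendsto (fun i => ∫ t, fourier m t ∂(μs i : Measure (AddCircle T))) l
      (𝓝 (∫ t, fourier m t ∂(μ : Measure (AddCircle T))))) :
    Tendsto μs l (𝓝 μ) := by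
  have hint : ∀ (ν : ProbabilityMeasure (AddCircle T)) (f : C(AddCircle T, ℂ)),
      Integrable f (ν : Measure (AddCircle T)) := fun ν f =>
    f.continuous.integrable_of_hasCompactSupport (HasCompactSupport.of_compactSpace f)
  have hspan : ∀ g ∈ Submodule.span ℂ (Set.range (@fourier T)),
      Tendsto (fun i => ∫ t, g t ∂(μs i : Measure (AddCircle T))) l
        (𝓝 (∫ t, g t ∂(μ : Measure (AddCircle T)))) := by
    intro g hg
    induction hg using Submodule.span_induction with
    | mem g hg =>
      obtain ⟨m, rfl⟩ := hg
      exact h m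
    | zero => simpa using tendsto_const_nhds
    | add f g _ _ hf hg =>
      simp only [ContinuousMap.add_apply]
      simp only [integral_add (hint _ f) (hint _ g)]
      exact hf.add hg
    | smul c g _ hg =>
      simp only [ContinuousMap.smul_apply, integral_smul]
      exact hg.const_smul c
  have hdist : ∀ (ν : ProbabilityMeasure (AddCircle T)) (f g : C(AddCircle T, ℂ)),
      dist (∫ t, f t ∂(ν : Measure (AddCircle T))) (∫ t, g t ∂(ν : Measure (AddCircle T)))
        ≤ dist f g := by
    intro ν f g
    rw [dist_eq_norm, ← integral_sub (hint ν f) (hint ν g)]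
    refine (norm_integral_le_of_norm_le_const (C := dist f g)
      (Eventually.of_forall fun t => ?_)).trans (by simp)
    rw [← dist_eq_norm]
    exact ContinuousMap.dist_apply_le_dist t
  rw [ProbabilityMeasure.tendsto_iff_forall_integral_rclike_tendsto ℂ]
  intro f
  let f' : C(AddCircle T, ℂ) := f.toContinuousMap
  have hf' : f' ∈ (Submodule.span ℂ (Set.range (@fourier T))).topologicalClosure := by
    rw [span_fourier_closure_eq_top]
    trivial
  change Tendsto (fun i => ∫ t, f' t ∂(μs i : Measure (AddCircle T))) l
    (𝓝 (∫ t, f' t ∂(μ : Measure (AddCircle T))))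
  rw [Metric.tendsto_nhds]
  intro ε hε
  obtain ⟨g, hg, hfg⟩ := Metric.mem_closure_iff.1 hf' (ε / 3) (by positivity)
  filter_upwards [Metric.tendsto_nhds.1 (hspan g hg) (ε / 3) (by positivity)] with i hi
  have h1 := hdist (μs i) f' g
  have h2 := hdist μ f' g
  rw [dist_comm] at h2
  have h3 := dist_triangle4 (∫ t, f' t ∂(μs i : Measure (AddCircle T)))
    (∫ t, g t ∂(μs i : Measure (AddCircle T))) (∫ t, g t ∂(μ : Measure (AddCircle T)))
    (∫ t, f' t ∂(μ : Measure (AddCircle T)))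
  linarith

lemma fourier_coe_one (m : ℤ) (y : ℝ) : fourier m (y : AddCircle (1 : ℝ)) = torusChar m y := by
  rw [fourier_coe_apply, torusChar]
  congr 1
  push_cast
  ring

lemma integral_fourier_eq_zero {m : ℤ} (hm : m ≠ 0) :
    ∫ t : AddCircle (1 : ℝ), fourier m t = 0 :=
  integral_eq_zero_of_add_right_eq_neg
    (fourier_add_half_inv_index hm zero_lt_one)

/-- The image in the circle of a half-open interval in `[0, 1]`. -/
def circleArc (a b : ℝ) : Set (AddCircle (1 : ℝ)) :=
  (fun y : ℝ => (y : AddCircle (1 : ℝ))) '' Set.Ico a b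

lemma coe_mem_circleArc {a b : ℝ} (ha : 0 ≤ a) (hb : b ≤ 1) (y : ℝ) :
    (y : AddCircle (1 : ℝ)) ∈ circleArc a b ↔ a ≤ Int.fract y ∧ Int.fract y < b := by
  have hfr : ((Int.fract y : ℝ) : AddCircle (1 : ℝ)) = y := by
    rw [← Int.self_sub_floor, ← sub_eq_zero, ← AddCircle.coe_sub, AddCircle.coe_eq_zero_iff]
    exact ⟨-⌊y⌋, by simp⟩
  constructor
  · rintro ⟨z, ⟨hz1, hz2⟩, hzy⟩
    have : Int.fract y = z := by
      have hmem : ∀ w : ℝ, 0 ≤ w → w < 1 → w ∈ Set.Ico (0 : ℝ) (0 + 1) := fun w h0 h1 =>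
        ⟨h0, by rwa [zero_add]⟩
      refine (AddCircle.coe_eq_coe_iff_of_mem_Ico (hmem _ (Int.fract_nonneg y) (Int.fract_lt_one y))
        (hmem _ (ha.trans hz1) (hz2.trans_le hb))).1 ?_
      rw [hfr]
      exact hzy.symm
    rw [this]
    exact ⟨hz1, hz2⟩
  · exact fun hy => ⟨Int.fract y, hy, hfr⟩

lemma volume_circle_singleton (t : AddCircle (1 : ℝ)) : volume {t} = 0 := by
  have := AddCircle.volume_closedBall (T := 1) (x := t) 0
  simpa using this

lemma volume_frontier_circleArc (a b : ℝ) :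
    volume (frontier (circleArc a b)) = 0 := by
  let π : ℝ → AddCircle (1 : ℝ) := fun y => y
  have hcont : Continuous π := AddCircle.continuous_mk' 1
  have hopen : IsOpenMap π := QuotientAddGroup.isOpenMap_coe
  have hclos : closure (circleArc a b) ⊆ π '' Set.Icc a b :=
    closure_minimal (Set.image_mono Set.Ico_subset_Icc_self)
      (isCompact_Icc.image hcont).isClosed
  have hint : π '' Set.Ioo a b ⊆ interior (circleArc a b) :=
    interior_maximal (Set.image_mono Set.Ioo_subset_Ico_self) (hopen _ isOpen_Ioo)
  have hsub : frontier (circleArc a b) ⊆ {π a} ∪ {π b} := by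
    rintro t ⟨ht1, ht2⟩
    obtain ⟨y, hy, rfl⟩ := hclos ht1
    rcases eq_or_lt_of_le hy.1 with h1 | h1
    · exact Or.inl (by rw [← h1]; rfl)
    rcases eq_or_lt_of_le hy.2 with h2 | h2
    · exact Or.inr (by rw [h2]; rfl)
    exact absurd (hint ⟨y, ⟨h1, h2⟩, rfl⟩) ht2
  exact measure_mono_null hsub (measure_union_null (volume_circle_singleton _)
    (volume_circle_singleton _))

lemma measurableSet_circleArc (a b : ℝ) : MeasurableSet (circleArc a b) := by
  rcases le_or_gt b a with h | h
  · simp [circleArc, Set.Ico_eq_empty_of_le h]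
  · rw [circleArc, ← Set.Ioo_insert_left h, Set.image_insert_eq]
    exact (QuotientAddGroup.isOpenMap_coe _ isOpen_Ioo).measurableSet.insert _

lemma volume_circleArc {a b : ℝ} (ha : 0 ≤ a) (hb : b ≤ 1) :
    volume (circleArc a b) = ENNReal.ofReal (b - a) := by
  have hpre : (QuotientAddGroup.mk ⁻¹' circleArc a b : Set ℝ) =
      Int.fract ⁻¹' Set.Ico a b := by
    ext y
    exact coe_mem_circleArc ha hb y
  rw [AddCircle.add_projection_respects_measure 1 0 (measurableSet_circleArc a b), hpre, zero_add,
    measure_congr ((ae_eq_refl (Int.fract ⁻¹' Set.Ico a b)).inter Ioc_ae_eq_Icc),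
    ← measure_congr ((ae_eq_refl (Int.fract ⁻¹' Set.Ico a b)).inter Ico_ae_eq_Icc),
    ← Real.volume_Ico]
  congr 1
  ext y
  simp only [Set.mem_inter_iff, Set.mem_preimage, Set.mem_Ico]
  constructor
  · rintro ⟨hy, hy1⟩
    rwa [Int.fract_eq_self.2 hy1] at hy
  · intro hy
    have hy1 : 0 ≤ y ∧ y < 1 := ⟨ha.trans hy.1, hy.2.trans_le hb⟩
    rw [Int.fract_eq_self.2 hy1]
    exact ⟨hy, hy1⟩

/-- The normalized counting measure of the first `N + 1` terms of a sequence, on the circle. -/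
def empiricalMeasure (x : ℕ → ℝ) (N : ℕ) : Measure (AddCircle (1 : ℝ)) :=
  ((N + 1 : ℕ) : ENNReal)⁻¹ •
    ∑ n ∈ Finset.Icc 1 (N + 1), Measure.dirac (x n : AddCircle (1 : ℝ))

instance (x : ℕ → ℝ) (N : ℕ) : IsProbabilityMeasure (empiricalMeasure x N) where
  measure_univ := by
    simp only [empiricalMeasure, Measure.smul_apply, Measure.finsetSum_apply, measure_univ,
      Finset.sum_const, Nat.card_Icc, smul_eq_mul, nsmul_eq_mul, mul_one, Nat.add_sub_cancel]
    exact ENNReal.inv_mul_cancel (by simp) (by simp)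

lemma integral_empiricalMeasure (x : ℕ → ℝ) (N : ℕ) (f : C(AddCircle (1 : ℝ), ℂ)) :
    ∫ t, f t ∂empiricalMeasure x N
      = (∑ n ∈ Finset.Icc 1 (N + 1), f (x n : AddCircle (1 : ℝ))) / ((N + 1 : ℕ) : ℂ) := by
  rw [empiricalMeasure, integral_smul_measure, integral_finsetSum_measure]
  · simp only [integral_dirac, ENNReal.toReal_inv, ENNReal.toReal_natCast, Complex.real_smul]
    push_cast
    rw [div_eq_inv_mul]
  · exact fun _ _ => f.continuous.integrable_of_hasCompactSupport
      (HasCompactSupport.of_compactSpace f)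

lemma empiricalMeasure_circleArc (x : ℕ → ℝ) (N : ℕ) {a b : ℝ} (ha : 0 ≤ a) (hb : b ≤ 1) :
    (empiricalMeasure x N (circleArc a b)).toReal
      = (((Finset.Icc 1 (N + 1)).filter
        (fun n => a ≤ Int.fract (x n) ∧ Int.fract (x n) < b)).card : ℝ) / ((N + 1 : ℕ) : ℝ) := by
  have : ∀ n, Measure.dirac (x n : AddCircle (1 : ℝ)) (circleArc a b)
      = ((if a ≤ Int.fract (x n) ∧ Int.fract (x n) < b then 1 else 0 : ℕ) : ENNReal) := by
    intro n
    rw [Measure.dirac_apply' _ (measurableSet_circleArc a b), Set.indicator_apply,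
      coe_mem_circleArc ha hb]
    split_ifs <;> simp
  simp only [empiricalMeasure, Measure.smul_apply, Measure.finsetSum_apply, this]
  rw [← Nat.cast_sum, ← Finset.card_filter, smul_eq_mul, ENNReal.toReal_mul, ENNReal.toReal_inv,
    ENNReal.toReal_natCast, ENNReal.toReal_natCast, div_eq_inv_mul]

/-- **Weyl's criterion**. -/
theorem equidistributed_of_tendsto_torusChar (x : ℕ → ℝ)
    (h : ∀ m : ℤ, m ≠ 0 →
      Tendsto (fun N : ℕ => (∑ n ∈ Finset.Icc 1 N, torusChar m (x n)) / (N : ℂ)) atTop (𝓝 0)) :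
    Equidistributed x := by
  have : IsProbabilityMeasure (volume : Measure (AddCircle (1 : ℝ))) :=
    ⟨by rw [AddCircle.measure_univ, ENNReal.ofReal_one]⟩
  let μ : ProbabilityMeasure (AddCircle (1 : ℝ)) := ⟨volume, this⟩
  let μs : ℕ → ProbabilityMeasure (AddCircle (1 : ℝ)) := fun N =>
    ⟨empiricalMeasure x N, inferInstance⟩
  have hlim : Tendsto μs atTop (𝓝 μ) := by
    refine ProbabilityMeasure.tendsto_of_tendsto_integral_fourier fun m => ?_
    change Tendsto (fun N => ∫ t, fourier m t ∂empiricalMeasure x N) atTop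
      (𝓝 (∫ t : AddCircle (1 : ℝ), fourier m t))
    rcases eq_or_ne m 0 with rfl | hm
    · simp
    · rw [integral_fourier_eq_zero hm]
      simp only [integral_empiricalMeasure, fourier_coe_one]
      exact (tendsto_add_atTop_iff_nat 1).2 (h m hm)
  intro a b ha hab hb
  have h1 : Tendsto (fun N => empiricalMeasure x N (circleArc a b)) atTop
      (𝓝 (volume (circleArc a b))) :=
    ProbabilityMeasure.tendsto_measure_of_null_frontier_of_tendsto' hlim
      (volume_frontier_circleArc a b)
  have h2 := (ENNReal.tendsto_toReal (measure_ne_top volume (circleArc a b))).comp h1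
  rw [volume_circleArc ha hb, ENNReal.toReal_ofReal (sub_nonneg.2 hab)] at h2
  refine (tendsto_add_atTop_iff_nat 1).1 (h2.congr fun N => ?_)
  exact empiricalMeasure_circleArc x N ha hb

/-- The `k`-tuples with entries in `{1, …, N}`. -/
abbrev tuples (k N : ℕ) : Finset (Fin k → ℕ) := Fintype.piFinset fun _ : Fin k => Finset.Icc 1 N

lemma card_tuples (k N : ℕ) : (tuples k N).card = N ^ k := by
  simp

lemma card_pairs_same_multiset_le (k N : ℕ) :
    ((tuples k N ×ˢ tuples k N).filter fun p =>
      (↑(List.ofFn p.1) : Multiset ℕ) = ↑(List.ofFn p.2)).card ≤ k ^ k * N ^ k := by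
  have hsub : ((tuples k N ×ˢ tuples k N).filter fun p =>
      (↑(List.ofFn p.1) : Multiset ℕ) = ↑(List.ofFn p.2)) ⊆
      (tuples k N).biUnion fun a =>
        (Fintype.piFinset fun _ : Fin k => Finset.univ.image a).image fun b => (a, b) := by
    rintro ⟨a, b⟩ hab
    obtain ⟨h1, h2⟩ := Finset.mem_filter.1 hab
    refine Finset.mem_biUnion.2 ⟨a, (Finset.mem_product.1 h1).1, Finset.mem_image_of_mem _ ?_⟩
    refine Fintype.mem_piFinset.2 fun j => ?_
    have h3 : b j ∈ (↑(List.ofFn a) : Multiset ℕ) := by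
      rw [h2, Multiset.mem_coe, List.mem_ofFn]
      exact ⟨j, rfl⟩
    rw [Multiset.mem_coe, List.mem_ofFn] at h3
    obtain ⟨i, hi⟩ := h3
    exact Finset.mem_image.2 ⟨i, Finset.mem_univ _, hi⟩
  refine (Finset.card_le_card hsub).trans ?_
  rw [mul_comm, ← card_tuples]
  refine Finset.card_biUnion_le_card_mul _ _ _ fun a _ => Finset.card_image_le.trans ?_
  rw [Fintype.card_piFinset_const]
  gcongr
  exact Finset.card_image_le.trans (by simp)

lemma card_pairs_le_kfoldCount (x : ℕ → ℝ) (k N : ℕ) {ε δ : ℝ} (hε : ε ≤ δ) :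
    ((tuples k N ×ˢ tuples k N).filter fun p =>
      tdist (∑ j, x (p.1 j) - ∑ j, x (p.2 j)) ≤ ε).card
      ≤ kfoldCount x k N δ + k ^ k * N ^ k := by
  refine le_trans ?_ (Nat.add_le_add_left (card_pairs_same_multiset_le k N) _)
  refine le_trans (Finset.card_le_card ?_) (Finset.card_union_le _ _)
  intro p hp
  rw [Finset.mem_filter] at hp
  by_cases h : (↑(List.ofFn p.1) : Multiset ℕ) = ↑(List.ofFn p.2)
  · exact Finset.mem_union_right _ (Finset.mem_filter.2 ⟨hp.1, h⟩)
  · exact Finset.mem_union_left _ (Finset.mem_filter.2 ⟨hp.1, h, hp.2.trans hε⟩)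

lemma kfoldCount_le (x : ℕ → ℝ) (k N : ℕ) (ε : ℝ) : kfoldCount x k N ε ≤ N ^ (2 * k) := by
  refine (Finset.card_filter_le _ _).trans ?_
  rw [Finset.card_product, card_tuples, two_mul, pow_add]

lemma sum_tuples_torusChar (x : ℕ → ℝ) (k N : ℕ) (m : ℤ) :
    ∑ a ∈ tuples k N, torusChar m (∑ j, x (a j))
      = (∑ n ∈ Finset.Icc 1 N, torusChar m (x n)) ^ k := by
  rw [Finset.sum_pow']
  simp only [torusChar_sum]

lemma norm_torusChar_average_pow_le (x : ℕ → ℝ) {k N L M : ℕ} {α : ℝ} {m : ℤ} (hαk : α ≤ k)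
    (hN : 0 < N) (hL : 0 < L) (hLM : 2 * L ≤ M) (hNM : (N : ℝ) ^ α ≤ M) (hm : ¬ (M : ℤ) ∣ m) :
    ‖(∑ n ∈ Finset.Icc 1 N, torusChar m (x n)) / (N : ℂ)‖ ^ k ≤
      2 * Real.pi * |(m : ℝ)| * (L / M) +
      √((M / (N : ℝ) ^ α) * ((∑ r ∈ Finset.Icc 1 L,
        (kfoldCount x k N (r / (N : ℝ) ^ α) : ℝ) / (N : ℝ) ^ (2 * (k : ℝ) - α)
          + L * (k : ℝ) ^ k) / L ^ 2) - 1) := by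
  have : NeZero M := ⟨by omega⟩
  have hN' : (0 : ℝ) < N := by exact_mod_cast hN
  have hN1 : (1 : ℝ) ≤ N := by exact_mod_cast hN
  have hM : (0 : ℝ) < M := by exact_mod_cast (show 0 < M by omega)
  have hL' : (0 : ℝ) < L := by exact_mod_cast hL
  have hNα : 0 < (N : ℝ) ^ α := Real.rpow_pos_of_pos hN' α
  have hV : (0 : ℝ) < (N : ℝ) ^ k := by positivity
  have hkey := norm_sum_torusChar_le (tuples k N) (fun a => ∑ j, x (a j)) M L hL hLM m hm
  rw [sum_tuples_torusChar, card_tuples, norm_pow, Nat.cast_pow] at hkey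
  set Q : ℝ := ∑ r ∈ Finset.Icc 1 L, (((tuples k N ×ˢ tuples k N).filter fun p =>
        tdist (∑ j, x (p.1 j) - ∑ j, x (p.2 j)) ≤ (r : ℝ) / M).card : ℝ) with hQ
  set C : ℝ := ∑ r ∈ Finset.Icc 1 L, (kfoldCount x k N (r / (N : ℝ) ^ α) : ℝ) with hC
  have hQC : Q ≤ C + L * ((k : ℝ) ^ k * (N : ℝ) ^ k) := by
    have h1 : Q ≤ ∑ r ∈ Finset.Icc 1 L, ((kfoldCount x k N (r / (N : ℝ) ^ α) : ℝ)
        + (k : ℝ) ^ k * (N : ℝ) ^ k) := by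
      refine Finset.sum_le_sum fun r _ => ?_
      have hr : (r : ℝ) / M ≤ r / (N : ℝ) ^ α := by gcongr
      exact_mod_cast card_pairs_le_kfoldCount x k N hr
    rwa [Finset.sum_add_distrib, Finset.sum_const, Nat.card_Icc, Nat.add_sub_cancel,
      nsmul_eq_mul] at h1
  have hpow : (N : ℝ) ^ (2 * (k : ℝ) - α) = ((N : ℝ) ^ k) ^ 2 / (N : ℝ) ^ α := by
    rw [Real.rpow_sub hN', ← pow_mul, mul_comm k 2, ← Real.rpow_natCast]
    push_cast
    rfl
  have hNαk : (N : ℝ) ^ α ≤ (N : ℝ) ^ k := by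
    rw [← Real.rpow_natCast]
    exact Real.rpow_le_rpow_of_exponent_le hN1 hαk
  have hbound : (M * Q / L ^ 2 - ((N : ℝ) ^ k) ^ 2) / ((N : ℝ) ^ k) ^ 2 ≤
      (M / (N : ℝ) ^ α) * ((∑ r ∈ Finset.Icc 1 L,
        (kfoldCount x k N (r / (N : ℝ) ^ α) : ℝ) / (N : ℝ) ^ (2 * (k : ℝ) - α)
          + L * (k : ℝ) ^ k) / L ^ 2) - 1 := by
    rw [← Finset.sum_div, ← hC, hpow, sub_div, div_self (by positivity)]
    gcongr
    have h1 : Q * (N : ℝ) ^ α ≤ C * (N : ℝ) ^ α + L * (k : ℝ) ^ k * ((N : ℝ) ^ k) ^ 2 := by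
      calc Q * (N : ℝ) ^ α ≤ (C + L * ((k : ℝ) ^ k * (N : ℝ) ^ k)) * (N : ℝ) ^ α := by gcongr
        _ = C * (N : ℝ) ^ α + L * ((k : ℝ) ^ k * (N : ℝ) ^ k) * (N : ℝ) ^ α := by ring
        _ ≤ C * (N : ℝ) ^ α + L * ((k : ℝ) ^ k * (N : ℝ) ^ k) * (N : ℝ) ^ k := by gcongr
        _ = _ := by ring
    calc M * Q / L ^ 2 / ((N : ℝ) ^ k) ^ 2
        = M / ((N : ℝ) ^ α * L ^ 2 * ((N : ℝ) ^ k) ^ 2) * (Q * (N : ℝ) ^ α) := by field_simp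
      _ ≤ M / ((N : ℝ) ^ α * L ^ 2 * ((N : ℝ) ^ k) ^ 2)
          * (C * (N : ℝ) ^ α + L * (k : ℝ) ^ k * ((N : ℝ) ^ k) ^ 2) := by gcongr
      _ = _ := by field_simp
  rw [norm_div, Complex.norm_natCast, div_pow, div_le_iff₀ hV]
  refine hkey.trans ?_
  have hsqrt : √(M * Q / L ^ 2 - ((N : ℝ) ^ k) ^ 2)
      = √((M * Q / L ^ 2 - ((N : ℝ) ^ k) ^ 2) / ((N : ℝ) ^ k) ^ 2) * (N : ℝ) ^ k := by
    rw [Real.sqrt_div' _ (by positivity), Real.sqrt_sq hV.le]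
    field_simp
  rw [hsqrt, add_mul, mul_comm ((N : ℝ) ^ k)]
  gcongr

lemma sum_Icc_two_mul (L : ℕ) : ∑ r ∈ Finset.Icc 1 L, 2 * (r : ℝ) = L * (L + 1) := by
  induction L with
  | zero => simp
  | succ n ih =>
    rw [Finset.sum_Icc_succ_top (by omega), ih]
    push_cast
    ring

lemma tendsto_torusChar_average (k : ℕ) (α : ℝ) (hα0 : 0 < α) (hαk : α ≤ k)
    (x : ℕ → ℝ)
    (h : ∀ s : ℝ, 0 < s →
      Tendsto (fun N : ℕ =>
          (kfoldCount x k N (s / (N : ℝ) ^ α) : ℝ) / (N : ℝ) ^ (2 * (k : ℝ) - α))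
        atTop (𝓝 (2 * s))) (m : ℤ) (hm : m ≠ 0) :
    Tendsto (fun N : ℕ => (∑ n ∈ Finset.Icc 1 N, torusChar m (x n)) / (N : ℂ)) atTop (𝓝 0) := by
  have hNα : Tendsto (fun N : ℕ => (N : ℝ) ^ α) atTop atTop :=
    (tendsto_rpow_atTop hα0).comp tendsto_natCast_atTop_atTop
  have hM : Tendsto (fun N : ℕ => ⌈(N : ℝ) ^ α⌉₊) atTop atTop := tendsto_nat_ceil_atTop.comp hNα
  have hMdiv : Tendsto (fun N : ℕ => (⌈(N : ℝ) ^ α⌉₊ : ℝ) / (N : ℝ) ^ α) atTop (𝓝 1) :=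
    (tendsto_nat_ceil_div_atTop (R := ℝ)).comp hNα
  rw [Metric.tendsto_nhds]
  intro ε hε
  obtain ⟨L, hL, hLε⟩ : ∃ L : ℕ, 0 < L ∧ √((1 + (k : ℝ) ^ k) / L) < ε ^ k := by
    have h1 : Tendsto (fun L : ℕ => √((1 + (k : ℝ) ^ k) / L)) atTop (𝓝 0) := by
      have := (Real.continuous_sqrt.tendsto 0).comp
        (tendsto_const_div_atTop_nhds_zero_nat (1 + (k : ℝ) ^ k))
      rwa [Real.sqrt_zero] at this
    obtain ⟨L, h2, h3⟩ := ((h1.eventually_lt_const (pow_pos hε k)).and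
      (eventually_gt_atTop 0)).exists
    exact ⟨L, h3, h2⟩
  have hL' : (0 : ℝ) < L := by exact_mod_cast hL
  have hlim : Tendsto (fun N : ℕ => 2 * Real.pi * |(m : ℝ)| * (L / (⌈(N : ℝ) ^ α⌉₊ : ℝ)) +
      √((⌈(N : ℝ) ^ α⌉₊ / (N : ℝ) ^ α) * ((∑ r ∈ Finset.Icc 1 L,
        (kfoldCount x k N (r / (N : ℝ) ^ α) : ℝ) / (N : ℝ) ^ (2 * (k : ℝ) - α)
          + L * (k : ℝ) ^ k) / L ^ 2) - 1)) atTop (𝓝 √((1 + (k : ℝ) ^ k) / L)) := by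
    have h1 : Tendsto (fun N : ℕ => 2 * Real.pi * |(m : ℝ)| * (L / (⌈(N : ℝ) ^ α⌉₊ : ℝ))) atTop
        (𝓝 (2 * Real.pi * |(m : ℝ)| * 0)) :=
      ((tendsto_const_div_atTop_nhds_zero_nat (L : ℝ)).comp hM).const_mul _
    have h2 : Tendsto (fun N : ℕ => ∑ r ∈ Finset.Icc 1 L,
        (kfoldCount x k N (r / (N : ℝ) ^ α) : ℝ) / (N : ℝ) ^ (2 * (k : ℝ) - α)) atTop
        (𝓝 (∑ r ∈ Finset.Icc 1 L, 2 * (r : ℝ))) :=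
      tendsto_finsetSum _ fun r hr => h r (by exact_mod_cast (Finset.mem_Icc.1 hr).1)
    have h3 := (Real.continuous_sqrt.tendsto _).comp
      ((hMdiv.mul ((h2.add_const (L * (k : ℝ) ^ k)).div_const (L ^ 2))).sub_const 1)
    have h4 : √((1 + (k : ℝ) ^ k) / L) = 2 * Real.pi * |(m : ℝ)| * 0 +
        √(1 * ((∑ r ∈ Finset.Icc 1 L, 2 * (r : ℝ) + L * (k : ℝ) ^ k) / L ^ 2) - 1) := by
      rw [sum_Icc_two_mul, mul_zero, zero_add]
      congr 1
      field_simp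
      ring
    rw [h4]
    exact h1.add h3
  filter_upwards [hlim.eventually_lt_const hLε, eventually_gt_atTop 0,
    hM.eventually_ge_atTop (2 * L), hM.eventually_gt_atTop m.natAbs] with N h1 hN h2 h3
  have hdvd : ¬ ((⌈(N : ℝ) ^ α⌉₊ : ℕ) : ℤ) ∣ m := by
    intro hd
    have := Nat.le_of_dvd (Int.natAbs_pos.2 hm) (Int.natCast_dvd.1 hd)
    omega
  have h4 := (norm_torusChar_average_pow_le x hαk hN hL h2 (Nat.le_ceil _) hdvd).trans_lt h1
  rw [dist_zero_right]
  exact lt_of_pow_lt_pow_left₀ k hε.le h4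

/-- Poissonian correlation of `2k`-fold differences at rate `α`, for any `0 ≤ α ≤ k`,
implies equidistribution. -/
theorem kfold_poissonian_rate_alpha_implies_equidistribution (k : ℕ) (hk : 1 ≤ k)
    (α : ℝ) (hα0 : 0 ≤ α) (hαk : α ≤ k) (x : ℕ → ℝ)
    (h : ∀ s : ℝ, 0 < s →
      Tendsto (fun N : ℕ =>
          (kfoldCount x k N (s / (N : ℝ) ^ α) : ℝ) / (N : ℝ) ^ (2 * (k : ℝ) - α))
        atTop (nhds (2 * s))) :
    Equidistributed x := by
  rcases hα0.eq_or_lt with rfl | hα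
  · have hle : ∀ N : ℕ, (kfoldCount x k N (1 / (N : ℝ) ^ (0 : ℝ)) : ℝ)
        / (N : ℝ) ^ (2 * (k : ℝ) - 0) ≤ 1 := fun N => by
      refine div_le_one_of_le₀ ?_ (by positivity)
      rw [sub_zero, show (2 * (k : ℝ)) = ((2 * k : ℕ) : ℝ) by push_cast; rfl, Real.rpow_natCast]
      exact_mod_cast kfoldCount_le x k N _
    have := le_of_tendsto' (h 1 one_pos) hle
    norm_num at this
  · exact equidistributed_of_tendsto_torusChar x (tendsto_torusChar_average k α hα hαk x h)
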